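/- Let F₂ be the free group with basis A = {a,b}, let ε be the automorphism of F₂ determined by a ↦ a⁻¹ and b ↦ b⁻¹, and let φ be an automorphism of F₂. Then φ satisfies a Lipschitz condition with respect to every visual metric d ∈ V^{A'}(p',γ',T) where A' ranges over all bases of F₂, if and only if φ ∈ ⟨Inn(F₂) ∪ {ε}⟩, equivalently there exist k ∈ {0,1} and x ∈ F₂ such that gφ = x⁻¹(gε^k)x for all g ∈ F₂. -/

import Mathlib

open scoped Classical

section Defs

variable {G : Type*}

/-- Word length of `g` with respect to a generating set `A`: the least `n` such that
`g` is a product of `n` elements of `A ∪ A⁻¹`. -/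
noncomputable def wordLength [Group G] (A : Set G) (g : G) : ℕ :=
  sInf {n : ℕ | ∃ w : List G, w.length = n ∧ (∀ x ∈ w, x ∈ A ∨ x⁻¹ ∈ A) ∧ w.prod = g}

/-- The word metric `d_A(g,h)` (as a real number). -/
noncomputable def wordDist [Group G] (A : Set G) (g h : G) : ℝ :=
  (wordLength A (g⁻¹ * h) : ℝ)

/-- The Gromov product `(x|y)_p` with respect to a distance function `d`. -/
noncomputable def gromov {X : Type*} (d : X → X → ℝ) (p x y : X) : ℝ :=
  (d p x + d p y - d x y) / 2

/-- `G` is `δ`-hyperbolic with respect to the generating set `A`. -/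
def IsHyperbolicWith [Group G] (A : Set G) (δ : ℝ) : Prop :=
  ∀ p g₀ g₁ g₂ : G,
    min (gromov (wordDist A) p g₀ g₁) (gromov (wordDist A) p g₁ g₂) - δ ≤
      gromov (wordDist A) p g₀ g₂

/-- `G` is hyperbolic with respect to the generating set `A`. -/
def IsHyperbolic [Group G] (A : Set G) : Prop :=
  ∃ δ : ℝ, 0 ≤ δ ∧ IsHyperbolicWith A δ

/-- `ρ_{p,γ}(g,h) = e^{-γ (g|h)_p}` (and `0` on the diagonal), with respect to a
distance function `dA`. -/
noncomputable def visualRhoOf {X : Type*} (dA : X → X → ℝ) (p : X) (γ : ℝ) (g h : X) : ℝ :=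
  if g = h then 0 else Real.exp (-γ * gromov dA p g h)

/-- `d` is a metric on `X`. -/
structure IsMetric {X : Type*} (d : X → X → ℝ) : Prop where
  refl : ∀ x, d x x = 0
  eq_of : ∀ x y, d x y = 0 → x = y
  symm : ∀ x y, d x y = d y x
  triangle : ∀ x y z, d x z ≤ d x y + d y z

/-- `d` is a visual metric in `V(p,γ,T)` with respect to the distance function `dA`. -/
def InVisualOf {X : Type*} (dA : X → X → ℝ) (p : X) (γ T : ℝ) (d : X → X → ℝ) : Prop :=
  IsMetric d ∧ ∀ g h : X, g ≠ h →
    visualRhoOf dA p γ g h / T ≤ d g h ∧ d g h ≤ T * visualRhoOf dA p γ g h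

/-- `d ∈ V^A(p,γ,T)`: `d` is a visual metric with respect to the word metric `d_A`. -/
def InVisual [Group G] (A : Set G) (p : G) (γ T : ℝ) (d : G → G → ℝ) : Prop :=
  InVisualOf (wordDist A) p γ T d

/-- `φ : (X,d) → (X,d')` satisfies a Hölder condition of exponent `r`. -/
def HolderCondWith {X : Type*} (d d' : X → X → ℝ) (φ : X → X) (r : ℝ) : Prop :=
  ∃ K : ℝ, 0 < K ∧ ∀ g h : X, d' (φ g) (φ h) ≤ K * d g h ^ r

/-- `φ : (X,d) → (X,d')` satisfies a Hölder condition (of some positive exponent). -/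
def SatisfiesHolder {X : Type*} (d d' : X → X → ℝ) (φ : X → X) : Prop :=
  ∃ r : ℝ, 0 < r ∧ HolderCondWith d d' φ r

/-- `φ : (X,d) → (X,d')` satisfies a Lipschitz condition. -/
def LipschitzCond {X : Type*} (d d' : X → X → ℝ) (φ : X → X) : Prop :=
  ∃ K : ℝ, 0 < K ∧ ∀ g h : X, d' (φ g) (φ h) ≤ K * d g h

/-- `φ : (X,d) → (X,d')` is uniformly continuous. -/
def UnifCont {X : Type*} (d d' : X → X → ℝ) (φ : X → X) : Prop :=
  ∀ ε : ℝ, 0 < ε → ∃ δ : ℝ, 0 < δ ∧ ∀ g h : X, d g h < δ → d' (φ g) (φ h) < ε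

/-- `φ : (X,d) → (X,d')` is a quasi-isometric embedding. -/
def QIEmbedding {X : Type*} (d d' : X → X → ℝ) (φ : X → X) : Prop :=
  ∃ lam K : ℝ, 1 ≤ lam ∧ 0 ≤ K ∧ ∀ g h : X,
    (1 / lam) * d g h - K ≤ d' (φ g) (φ h) ∧ d' (φ g) (φ h) ≤ lam * d g h + K

/-- `H` is a quasiconvex subset of `G` with respect to the generating set `A`:
every geodesic word-metric chain joining two points of `H` stays at bounded
distance from `H`. -/
def IsQuasiconvex [Group G] (A : Set G) (H : Set G) : Prop :=
  ∃ q : ℝ, 0 ≤ q ∧ ∀ h ∈ H, ∀ h' ∈ H, ∀ n : ℕ, ∀ g : ℕ → G,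
    g 0 = h → g n = h' → (n : ℝ) = wordDist A h h' →
    (∀ i < n, wordDist A (g i) (g (i + 1)) = 1) →
    ∀ i ≤ n, ∃ z ∈ H, wordDist A (g i) z ≤ q

end Defs

namespace FreeGroup

theorem isReduced_append_iff {α : Type*} {L M : List (α × Bool)} :
    IsReduced (L ++ M) ↔ IsReduced L ∧ IsReduced M ∧
      ∀ a ∈ L.getLast?, ∀ b ∈ M.head?, a.1 = b.1 → a.2 = b.2 :=
  List.isChain_append

section Tree

variable {α : Type*} [DecidableEq α]

/-- The length of the longest common prefix of two lists. -/
def commonPrefixLength {β : Type*} [DecidableEq β] : List β → List β → ℕ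
  | a :: L, b :: M => if a = b then commonPrefixLength L M + 1 else 0
  | [], _ => 0
  | _ :: _, [] => 0

theorem commonPrefixLength_comm {β : Type*} [DecidableEq β] (L M : List β) :
    commonPrefixLength L M = commonPrefixLength M L := by
  induction L generalizing M with
  | nil => cases M <;> simp [commonPrefixLength]
  | cons a L ih =>
    cases M with
    | nil => simp [commonPrefixLength]
    | cons b M => simp only [commonPrefixLength, ih M, eq_comm]

theorem min_commonPrefixLength_le {β : Type*} [DecidableEq β] (L M N : List β) :
    min (commonPrefixLength L M) (commonPrefixLength M N) ≤ commonPrefixLength L N := by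
  induction L generalizing M N with
  | nil => cases M <;> simp [commonPrefixLength]
  | cons a L ih =>
    cases M with
    | nil => simp [commonPrefixLength]
    | cons b M =>
      cases N with
      | nil => simp [commonPrefixLength]
      | cons c N =>
        have := ih M N
        simp only [commonPrefixLength]
        split_ifs <;> first | omega | simp_all

theorem commonPrefixLength_take {β : Type*} [DecidableEq β] (L : List β) (m : ℕ)
    (h : m ≤ L.length) : commonPrefixLength L (L.take m) = m := by
  induction L generalizing m with
  | nil => simp at h; simp [commonPrefixLength, h]
  | cons a L ih =>
    cases m with
    | zero => simp [commonPrefixLength]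
    | succ m =>
      simp only [List.take_succ_cons, commonPrefixLength, if_true]
      rw [ih m (by simpa using h)]

theorem norm_mk_of_isReduced {L : List (α × Bool)} (h : IsReduced L) :
    norm (mk L) = L.length := by
  rw [norm, toWord_mk, h.reduce_eq]

theorem IsReduced.invRev_isReduced {L : List (α × Bool)} (h : IsReduced L) :
    IsReduced (invRev L) := by
  rw [isReduced_iff_reduce_eq, reduce_invRev, h.reduce_eq]

theorem norm_inv_mul_add_commonPrefixLength {L M : List (α × Bool)} (hL : IsReduced L)
    (hM : IsReduced M) :
    norm ((mk L)⁻¹ * mk M) + 2 * commonPrefixLength L M = L.length + M.length := by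
  induction L generalizing M with
  | nil =>
    rw [← one_eq_mk, inv_one, one_mul, norm_mk_of_isReduced hM]
    simp [commonPrefixLength]
  | cons a L ih =>
    cases M with
    | nil =>
      rw [← one_eq_mk, mul_one, norm_inv_eq, norm_mk_of_isReduced hL]
      simp [commonPrefixLength]
    | cons b M =>
      by_cases hab : a = b
      · subst hab
        have e1 : (mk (a :: L) : FreeGroup α) = mk [a] * mk L := by simp
        have e2 : (mk (a :: M) : FreeGroup α) = mk [a] * mk M := by simp
        have := ih (hL.infix (List.suffix_cons a L).isInfix)
          (hM.infix (List.suffix_cons a M).isInfix)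
        rw [e1, e2, mul_inv_rev, mul_assoc, inv_mul_cancel_left]
        simp only [commonPrefixLength, if_true, List.length_cons]
        omega
      · have hred : IsReduced (invRev (a :: L) ++ b :: M) := by
          rw [isReduced_append_iff]
          refine ⟨hL.invRev_isReduced, hM, ?_⟩
          intro x hx y hy hxy
          simp [invRev] at hx hy
          subst hx hy
          simp only at hxy
          by_contra hne
          apply hab
          ext
          · exact hxy
          · revert hne; cases a.2 <;> cases b.2 <;> simp
        rw [inv_mk, mul_mk, norm_mk_of_isReduced hred]
        simp [commonPrefixLength, hab]

/-- The Gromov product based at `1` on a free group, that is, the length of the longest common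
prefix of the reduced words. -/
def prefixProduct (x y : FreeGroup α) : ℕ :=
  commonPrefixLength x.toWord y.toWord

theorem prefixProduct_comm (x y : FreeGroup α) : prefixProduct x y = prefixProduct y x :=
  commonPrefixLength_comm _ _

theorem min_prefixProduct_le (x y z : FreeGroup α) :
    min (prefixProduct x y) (prefixProduct y z) ≤ prefixProduct x z :=
  min_commonPrefixLength_le _ _ _

theorem norm_inv_mul_add_prefixProduct (x y : FreeGroup α) :
    norm (x⁻¹ * y) + 2 * prefixProduct x y = norm x + norm y := by
  have := norm_inv_mul_add_commonPrefixLength (isReduced_toWord (x := x)) (isReduced_toWord (x := y))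
  rwa [mk_toWord, mk_toWord] at this

theorem norm_mul_add_prefixProduct (x y : FreeGroup α) :
    norm (x * y) + 2 * prefixProduct x⁻¹ y = norm x + norm y := by
  simpa using norm_inv_mul_add_prefixProduct x⁻¹ y

theorem exists_prefix (x : FreeGroup α) {m : ℕ} (h : m ≤ norm x) :
    ∃ r : FreeGroup α, norm r = m ∧ prefixProduct x r = m := by
  have hr : IsReduced (x.toWord.take m) :=
    (isReduced_toWord (x := x)).infix (List.take_prefix _ _).isInfix
  refine ⟨mk (x.toWord.take m), ?_, ?_⟩
  · rw [norm_mk_of_isReduced hr, List.length_take]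
    exact min_eq_left h
  · rw [prefixProduct, toWord_mk, hr.reduce_eq]
    exact commonPrefixLength_take _ _ h

/-- The length of the conjugacy class of `x`. -/
def cyclicNorm (x : FreeGroup α) : ℕ :=
  (reduceCyclically x.toWord).length

open reduceCyclically in
theorem norm_pow_succ (x : FreeGroup α) (n : ℕ) :
    norm (x ^ (n + 1)) =
      2 * (conjugator x.toWord).length + (n + 1) * cyclicNorm x := by
  rw [norm, toWord_pow, reduce_flatten_replicate_succ isReduced_toWord]
  simp [cyclicNorm]
  ring

open reduceCyclically in
theorem exists_eq_conj_norm_eq_cyclicNorm (x : FreeGroup α) :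
    ∃ c y : FreeGroup α, x = c * y * c⁻¹ ∧ norm y = cyclicNorm x := by
  refine ⟨mk (conjugator x.toWord), mk (reduceCyclically x.toWord), ?_, ?_⟩
  · conv_lhs => rw [← mk_toWord (x := x), ← conj_conjugator_reduceCyclically x.toWord]
    simp [inv_mk]
  · exact norm_mk_of_isReduced (isCyclicallyReduced isReduced_toWord).isReduced

theorem cyclicNorm_le_of_norm_pow_le {x : FreeGroup α} {k C : ℕ}
    (h : ∀ n : ℕ, norm (x ^ n) ≤ k * n + C) : cyclicNorm x ≤ k := by
  by_contra! hk
  have h1 := h (C + 1)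
  rw [norm_pow_succ] at h1
  have := Nat.mul_le_mul_left (C + 1) hk
  nlinarith

theorem norm_lt_norm_mul_self {x : FreeGroup α} (hx : x ≠ 1) : norm x < norm (x * x) := by
  obtain ⟨c, y, hxy, hy⟩ := exists_eq_conj_norm_eq_cyclicNorm x
  have h1 := norm_pow_succ x 0
  have h2 := norm_pow_succ x 1
  have : cyclicNorm x ≠ 0 := by
    intro h0
    rw [h0, norm_eq_zero] at hy
    exact hx (by simp [hxy, hy])
  rw [zero_add, pow_one] at h1
  rw [one_add_one_eq_two, pow_two] at h2
  omega

end Tree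

section Nielsen

variable {α : Type*} [DecidableEq α]

/-- The conditions under which products of elements of `S` have little cancellation. -/
structure IsNielsenReduced (S : Set (FreeGroup α)) : Prop where
  ne_one : ∀ x ∈ S, x ≠ 1
  two_mul_le_right : ∀ x ∈ S, ∀ y ∈ S, x * y ≠ 1 → 2 * prefixProduct x⁻¹ y ≤ norm y
  add_lt : ∀ x ∈ S, ∀ y ∈ S, ∀ z ∈ S, x * y ≠ 1 → y * z ≠ 1 →
    prefixProduct x⁻¹ y + prefixProduct y⁻¹ z < norm y

theorem IsNielsenReduced.length_le_norm_prod_cons {S : Set (FreeGroup α)}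
    (hS : IsNielsenReduced S) (x : FreeGroup α) (L : List (FreeGroup α))
    (hmem : ∀ y ∈ x :: L, y ∈ S) (hL : (x :: L).IsChain (fun y z => y * z ≠ 1)) :
    (x :: L).length ≤ norm (x :: L).prod ∧
      ∀ y ∈ S, y * x ≠ 1 → prefixProduct y⁻¹ (x :: L).prod = prefixProduct y⁻¹ x ∧
        (x :: L).length + prefixProduct y⁻¹ x ≤ norm (x :: L).prod := by
  induction L generalizing x with
  | nil =>
    have hx : x ∈ S := hmem x (by simp)
    have h1 : norm x ≠ 0 := fun h => hS.ne_one x hx (norm_eq_zero.1 h)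
    simp only [List.length_singleton, List.prod_singleton]
    refine ⟨by omega, fun y hy hyx => ⟨trivial, ?_⟩⟩
    have := hS.two_mul_le_right y hy x hx hyx
    omega
  | cons z L ih =>
    have hx : x ∈ S := hmem x (by simp)
    have hz : z ∈ S := hmem z (by simp)
    rw [List.isChain_cons_cons] at hL
    obtain ⟨-, ih⟩ := ih z (fun y hy => hmem y (List.mem_cons_of_mem _ hy)) hL.2
    obtain ⟨h1, h2⟩ := ih x hx hL.1
    rw [List.prod_cons, List.length_cons]
    generalize (z :: L).prod = W at *
    generalize (z :: L).length = n at *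
    have h3 := norm_mul_add_prefixProduct x W
    have h4 := hS.add_lt x hx x hx z hz
    have hxx : x * x ≠ 1 := fun h => by
      have := norm_lt_norm_mul_self (hS.ne_one x hx)
      simp [h] at this
    have h5 := h4 hxx hL.1
    refine ⟨by omega, fun y hy hyx => ?_⟩
    have h6 := hS.add_lt y hy x hx z hz hyx hL.1
    have h7 := norm_inv_mul_add_prefixProduct x (x * W)
    rw [inv_mul_cancel_left] at h7
    have h8 := min_prefixProduct_le y⁻¹ x (x * W)
    have h9 := min_prefixProduct_le y⁻¹ (x * W) x
    rw [prefixProduct_comm (x * W) x] at h9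
    omega

theorem IsNielsenReduced.mem_of_norm_eq_one {S : Set (FreeGroup α)}
    (hS : IsNielsenReduced S) (hinv : ∀ x ∈ S, x⁻¹ ∈ S) (hgen : Subgroup.closure S = ⊤)
    {g : FreeGroup α} (hg : norm g = 1) : g ∈ S := by
  have key : ∀ L : List (FreeGroup α), (∀ x ∈ L, x ∈ S) →
      ∃ M : List (FreeGroup α), (∀ x ∈ M, x ∈ S) ∧ M.prod = L.prod ∧
        M.IsChain (fun y z => y * z ≠ 1) := by
    intro L
    induction L with
    | nil => exact fun _ => ⟨[], by simp⟩
    | cons x L ih =>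
      intro h
      obtain ⟨M, h1, h2, h3⟩ := ih fun y hy => h y (List.mem_cons_of_mem _ hy)
      have hx : x ∈ S := h x (by simp)
      cases M with
      | nil => exact ⟨[x], by simpa using hx, by simp [← h2], by simp⟩
      | cons y M =>
        by_cases hxy : x * y = 1
        · refine ⟨M, fun z hz => h1 z (List.mem_cons_of_mem _ hz), ?_, h3.tail⟩
          rw [List.prod_cons, ← h2, List.prod_cons, ← mul_assoc, hxy, one_mul]
        · refine ⟨x :: y :: M, ?_, by rw [List.prod_cons, h2, List.prod_cons],
            List.isChain_cons_cons.2 ⟨hxy, h3⟩⟩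
          simpa [hx] using h1
  have hmem : g ∈ (Subgroup.closure S).toSubmonoid := hgen ▸ Subgroup.mem_top g
  rw [Subgroup.closure_toSubmonoid] at hmem
  obtain ⟨L, hL, rfl⟩ := Submonoid.exists_list_of_mem_closure hmem
  obtain ⟨M, h1, h2, h3⟩ := key L fun x hx => (hL x hx).elim id fun h => by
    simpa using hinv _ h
  rw [← h2] at hg ⊢
  match M with
  | [] => simp at hg
  | [x] => simpa using h1
  | x :: y :: M =>
    have := (hS.length_le_norm_prod_cons x (y :: M) h1 h3).1
    rw [hg] at this
    simp at this

/-- A property of pairs which can be pulled back along Nielsen moves and simultaneous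
conjugation. -/
structure IsNielsenInvariant (P : FreeGroup α → FreeGroup α → Prop) : Prop where
  swap : ∀ u v, P v u → P u v
  inv : ∀ u v, P u⁻¹ v → P u v
  mul : ∀ u v, P (u * v) v → P u v
  conj : ∀ r u v, P (r⁻¹ * u * r) (r⁻¹ * v * r) → P u v

/-- A generating pair of least total length among those violating `P`. -/
structure IsMinimalCounterexample (P : FreeGroup α → FreeGroup α → Prop)
    (u v : FreeGroup α) : Prop where
  closure_eq_top : Subgroup.closure {u, v} = ⊤
  not_holds : ¬ P u v
  min : ∀ u' v', Subgroup.closure {u', v'} = ⊤ → ¬ P u' v' →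
    norm u + norm v ≤ norm u' + norm v'

theorem closure_pair_eq_top_of_mem {G : Type*} [Group G] {u v u' v' : G}
    (h : Subgroup.closure {u, v} = ⊤) (hu : u ∈ Subgroup.closure {u', v'})
    (hv : v ∈ Subgroup.closure {u', v'}) : Subgroup.closure {u', v'} = ⊤ := by
  rw [eq_top_iff, ← h, Subgroup.closure_le]
  rintro x (rfl | rfl)
  exacts [hu, hv]

theorem closure_conj_pair_eq_top {G : Type*} [Group G] {u v : G} (r : G)
    (h : Subgroup.closure {u, v} = ⊤) :
    Subgroup.closure {r⁻¹ * u * r, r⁻¹ * v * r} = ⊤ := by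
  have := congrArg (Subgroup.map (MulAut.conj r⁻¹).toMonoidHom) h
  rw [MonoidHom.map_closure, Subgroup.map_top_of_surjective _ (MulAut.conj r⁻¹).surjective,
    Set.image_pair] at this
  simpa using this

theorem closure_one_pair_ne_top [Nontrivial α] (v : FreeGroup α) :
    Subgroup.closure {1, v} ≠ ⊤ := by
  intro h
  have h1 : Subgroup.closure {1, v} ≤ Subgroup.centralizer {v} := by
    rw [Subgroup.closure_le]
    rintro x (rfl | rfl)
    · exact one_mem _
    · simp [Subgroup.mem_centralizer_iff]
  have h2 : Subgroup.closure {1, v} ≤ Subgroup.center (FreeGroup α) := by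
    rw [Subgroup.closure_le]
    rintro x (rfl | rfl)
    · exact one_mem _
    · refine Subgroup.mem_center_iff.2 fun g => ?_
      have : g ∈ Subgroup.centralizer {x} := h1 (h ▸ Subgroup.mem_top g)
      rw [Subgroup.mem_centralizer_iff] at this
      exact (this x rfl).symm
  rw [h] at h2
  obtain ⟨i, j, hij⟩ := exists_pair_ne α
  have h3 := Subgroup.mem_center_iff.1 (h2 (Subgroup.mem_top (of i))) (of j)
  have h4 := congrArg toWord h3
  simp [toWord_mul, reduce.cons] at h4
  exact hij h4.1.symm

namespace IsMinimalCounterexample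

variable {P : FreeGroup α → FreeGroup α → Prop} {u v : FreeGroup α}

theorem swap (hP : IsNielsenInvariant P) (h : IsMinimalCounterexample P u v) :
    IsMinimalCounterexample P v u where
  closure_eq_top := by rw [Set.pair_comm]; exact h.closure_eq_top
  not_holds hvu := h.not_holds (hP.swap _ _ hvu)
  min u' v' h1 h2 := by rw [add_comm]; exact h.min u' v' h1 h2

theorem inv_left (hP : IsNielsenInvariant P) (h : IsMinimalCounterexample P u v) :
    IsMinimalCounterexample P u⁻¹ v where
  closure_eq_top := closure_pair_eq_top_of_mem h.closure_eq_top
    (by simpa using inv_mem (Subgroup.subset_closure (show u⁻¹ ∈ ({u⁻¹, v} : Set _) by simp)))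
    (Subgroup.subset_closure (by simp))
  not_holds hvu := h.not_holds (hP.inv _ _ hvu)
  min u' v' h1 h2 := by rw [norm_inv_eq]; exact h.min u' v' h1 h2

theorem inv_right (hP : IsNielsenInvariant P) (h : IsMinimalCounterexample P u v) :
    IsMinimalCounterexample P u v⁻¹ :=
  ((h.swap hP).inv_left hP).swap hP

theorem closure_mul_eq_top (h : IsMinimalCounterexample P u v) :
    Subgroup.closure {u * v, v} = ⊤ := by
  have h1 : u * v ∈ Subgroup.closure {u * v, v} := Subgroup.subset_closure (by simp)
  have h2 : v ∈ Subgroup.closure {u * v, v} := Subgroup.subset_closure (by simp)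
  exact closure_pair_eq_top_of_mem h.closure_eq_top
    (by simpa using mul_mem h1 (inv_mem h2)) h2

theorem norm_left_le (hP : IsNielsenInvariant P) (h : IsMinimalCounterexample P u v) :
    norm u ≤ norm (u * v) := by
  have := h.min _ _ h.closure_mul_eq_top fun h1 => h.not_holds (hP.mul _ _ h1)
  omega

theorem norm_right_le (hP : IsNielsenInvariant P) (h : IsMinimalCounterexample P u v) :
    norm v ≤ norm (u * v) := by
  have := (((h.inv_left hP).inv_right hP).swap hP).norm_left_le hP
  rwa [← mul_inv_rev, norm_inv_eq, norm_inv_eq] at this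

theorem ne_one [Nontrivial α] (h : IsMinimalCounterexample P u v) : u ≠ 1 := by
  rintro rfl
  exact closure_one_pair_ne_top v h.closure_eq_top

theorem two_mul_le_left (hP : IsNielsenInvariant P) (h : IsMinimalCounterexample P u v) :
    2 * prefixProduct u⁻¹ v ≤ norm u := by
  have h1 := norm_mul_add_prefixProduct u v
  have h2 := h.norm_right_le hP
  omega

theorem two_mul_le_right (hP : IsNielsenInvariant P) (h : IsMinimalCounterexample P u v) :
    2 * prefixProduct u⁻¹ v ≤ norm v := by
  have h1 := norm_mul_add_prefixProduct u v
  have h2 := h.norm_left_le hP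
  omega

theorem two_mul_self_lt {x : FreeGroup α} (hx : x ≠ 1) :
    2 * prefixProduct x⁻¹ x < norm x := by
  have h1 := norm_mul_add_prefixProduct x x
  have h2 := norm_lt_norm_mul_self hx
  omega

/-- If exactly half of `v` cancels on both sides of `u * v * u`, conjugating `(u * v, v)` by half
of `v` gives a shorter generating pair. -/
theorem add_lt_norm [Nontrivial α] (hP : IsNielsenInvariant P)
    (h : IsMinimalCounterexample P u v) :
    prefixProduct u⁻¹ v + prefixProduct v⁻¹ u < norm v := by
  by_contra! hle
  have h1 := h.two_mul_le_left hP
  have h2 := h.two_mul_le_right hP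
  have h3 := (h.swap hP).two_mul_le_left hP
  have h4 : norm v ≠ 0 := fun h0 => (h.swap hP).ne_one (norm_eq_zero.1 h0)
  obtain ⟨m, hm⟩ : ∃ m, norm v = 2 * m := ⟨prefixProduct u⁻¹ v, by omega⟩
  have h5 : prefixProduct u⁻¹ v = m := by omega
  have h6 : prefixProduct v⁻¹ u = m := by omega
  obtain ⟨r, hr, hvr⟩ := exists_prefix v⁻¹ (m := m) (by rw [norm_inv_eq]; omega)
  have e1 := norm_mul_add_prefixProduct v r
  have e2 := norm_mul_le r⁻¹ (v * r)
  rw [norm_inv_eq] at e2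
  have e3 := norm_inv_mul_add_prefixProduct v (v * r)
  rw [inv_mul_cancel_left] at e3
  have e4 := min_prefixProduct_le u⁻¹ v (v * r)
  have e5 := norm_mul_add_prefixProduct u (v * r)
  have e6 := norm_inv_mul_add_prefixProduct u (u * (v * r))
  rw [inv_mul_cancel_left] at e6
  have e7 := min_prefixProduct_le r u (u * (v * r))
  have e8 := min_prefixProduct_le r v⁻¹ u
  rw [prefixProduct_comm r v⁻¹] at e8
  have e9 := norm_inv_mul_add_prefixProduct r (u * (v * r))
  have e10 := norm_mul_le (u * (v * r)) (v * r)⁻¹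
  rw [mul_inv_cancel_right, norm_inv_eq] at e10
  have := h.min _ _ (closure_conj_pair_eq_top r h.closure_mul_eq_top)
    fun hh => h.not_holds (hP.mul _ _ (hP.conj _ _ _ hh))
  simp only [mul_assoc] at this
  omega

theorem isNielsenReduced [Nontrivial α] (hP : IsNielsenInvariant P)
    (h : IsMinimalCounterexample P u v) : IsNielsenReduced {u, u⁻¹, v, v⁻¹} := by
  have hne : ∀ x ∈ ({u, u⁻¹, v, v⁻¹} : Set (FreeGroup α)), x ≠ 1 := by
    rintro x (rfl | rfl | rfl | rfl)
    exacts [h.ne_one, (h.inv_left hP).ne_one, (h.swap hP).ne_one,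
      ((h.inv_right hP).swap hP).ne_one]
  have hpair : ∀ x ∈ ({u, u⁻¹, v, v⁻¹} : Set (FreeGroup α)),
      ∀ y ∈ ({u, u⁻¹, v, v⁻¹} : Set (FreeGroup α)), x * y ≠ 1 →
        x = y ∨ IsMinimalCounterexample P x y := by
    have a1 := h
    have a2 := h.inv_left hP
    have a3 := h.inv_right hP
    have a4 := a2.inv_right hP
    have b1 := a1.swap hP
    have b2 := a2.swap hP
    have b3 := a3.swap hP
    have b4 := a4.swap hP
    rintro x (rfl | rfl | rfl | rfl) y (rfl | rfl | rfl | rfl) hxy <;> simp_all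
  have htriple : ∀ x ∈ ({u, u⁻¹, v, v⁻¹} : Set (FreeGroup α)),
      ∀ y ∈ ({u, u⁻¹, v, v⁻¹} : Set (FreeGroup α)),
      ∀ z ∈ ({u, u⁻¹, v, v⁻¹} : Set (FreeGroup α)), x * y ≠ 1 → y * z ≠ 1 →
        x = y ∨ y = z ∨ z = x ∨ z = x⁻¹ := by
    rintro x (rfl | rfl | rfl | rfl) y (rfl | rfl | rfl | rfl) z (rfl | rfl | rfl | rfl) <;> simp
  have hright : ∀ x ∈ ({u, u⁻¹, v, v⁻¹} : Set (FreeGroup α)),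
      ∀ y ∈ ({u, u⁻¹, v, v⁻¹} : Set (FreeGroup α)), x * y ≠ 1 →
        2 * prefixProduct x⁻¹ y ≤ norm x ∧ 2 * prefixProduct x⁻¹ y ≤ norm y := by
    intro x hx y hy hxy
    rcases hpair x hx y hy hxy with rfl | hM
    · have := two_mul_self_lt (hne x hx)
      omega
    · exact ⟨hM.two_mul_le_left hP, hM.two_mul_le_right hP⟩
  refine ⟨hne, fun x hx y hy hxy => (hright x hx y hy hxy).2, ?_⟩
  intro x hx y hy z hz hxy hyz
  have h1 := (hright x hx y hy hxy).2
  have h2 := (hright y hy z hz hyz).1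
  have h3 := two_mul_self_lt (hne y hy)
  rcases hpair x hx y hy hxy with rfl | hM
  · omega
  rcases htriple x hx y hy z hz hxy hyz with rfl | rfl | rfl | rfl
  · omega
  · omega
  · exact hM.add_lt_norm hP
  · have h4 := min_prefixProduct_le y⁻¹ x⁻¹ y
    omega

end IsMinimalCounterexample

theorem IsNielsenInvariant.holds_of_closure_eq_top [Nontrivial α]
    {P : FreeGroup α → FreeGroup α → Prop} (hP : IsNielsenInvariant P)
    (hbase : ∀ u v, (∀ g : FreeGroup α, norm g = 1 → g = u ∨ g = u⁻¹ ∨ g = v ∨ g = v⁻¹) → P u v)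
    {u v : FreeGroup α} (h : Subgroup.closure {u, v} = ⊤) : P u v := by
  by_contra hnot
  let T : Set (FreeGroup α × FreeGroup α) :=
    {p | Subgroup.closure {p.1, p.2} = ⊤ ∧ ¬ P p.1 p.2}
  obtain ⟨⟨u, v⟩, ⟨h1, h2⟩, h3⟩ := exists_minimalFor_of_wellFoundedLT (· ∈ T)
    (fun p => norm p.1 + norm p.2) ⟨(u, v), h, hnot⟩
  have hM : IsMinimalCounterexample P u v := by
    refine ⟨h1, h2, fun u' v' h1' h2' => ?_⟩
    by_contra! hlt
    exact absurd (h3 (j := (u', v')) ⟨h1', h2'⟩ hlt.le) (not_le.2 hlt)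
  refine h2 (hbase u v fun g hg => ?_)
  refine (hM.isNielsenReduced hP).mem_of_norm_eq_one ?_ ?_ hg
  · rintro x (rfl | rfl | rfl | rfl) <;> simp
  · rw [eq_top_iff, ← h1]
    exact Subgroup.closure_mono (by rintro x (rfl | rfl) <;> simp)

end Nielsen

section WordMetric

variable {α : Type*} [DecidableEq α]

theorem norm_eq_one_iff {g : FreeGroup α} : norm g = 1 ↔ ∃ p, g = mk [p] := by
  constructor
  · intro h
    obtain ⟨p, hp⟩ := List.length_eq_one_iff.1 h
    exact ⟨p, by rw [← hp, mk_toWord]⟩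
  · rintro ⟨p, rfl⟩
    exact norm_mk_of_isReduced IsReduced.singleton

theorem norm_list_prod_le {L : List (FreeGroup α)} (h : ∀ x ∈ L, norm x ≤ 1) :
    norm L.prod ≤ L.length := by
  induction L with
  | nil => simp
  | cons x L ih =>
    rw [List.prod_cons, List.length_cons]
    have h1 := norm_mul_le x L.prod
    have h2 := h x (by simp)
    have h3 := ih fun y hy => h y (List.mem_cons_of_mem _ hy)
    omega

theorem wordLength_range_basis (ψ : FreeGroup α ≃* FreeGroup α) (g : FreeGroup α) :
    wordLength (Set.range fun a => ψ (of a)) g = norm (ψ.symm g) := by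
  have hmem : norm (ψ.symm g) ∈ {n : ℕ | ∃ w : List (FreeGroup α), w.length = n ∧
      (∀ x ∈ w, x ∈ Set.range (fun a => ψ (of a)) ∨ x⁻¹ ∈ Set.range fun a => ψ (of a)) ∧
        w.prod = g} := by
    refine ⟨(ψ.symm g).toWord.map fun p => ψ (mk [p]), ?_, ?_, ?_⟩
    · rw [List.length_map]; rfl
    · simp only [List.mem_map]
      rintro x ⟨⟨a, b⟩, -, rfl⟩
      cases b
      · right
        refine ⟨a, ?_⟩
        rw [← _root_.map_inv, inv_mk]
        rfl
      · left
        exact ⟨a, rfl⟩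
    · rw [← Function.comp_def ψ, ← List.map_map, ← map_list_prod, ← MulEquiv.eq_symm_apply]
      conv_rhs => rw [← mk_toWord (x := ψ.symm g)]
      generalize (ψ.symm g).toWord = L
      induction L with
      | nil => simp [one_eq_mk]
      | cons p L ih => simp [ih]
  refine le_antisymm (Nat.sInf_le hmem) (le_csInf ⟨_, hmem⟩ ?_)
  rintro n ⟨L, rfl, h1, rfl⟩
  rw [map_list_prod]
  refine (norm_list_prod_le ?_).trans (by simp)
  simp only [List.mem_map]
  rintro y ⟨x, hx, rfl⟩
  rcases h1 x hx with ⟨a, ha⟩ | ⟨a, ha⟩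
  · simp [← ha]
  · rw [← norm_inv_eq, ← _root_.map_inv, ← ha]
    simp

theorem wordDist_range_basis (ψ : FreeGroup α ≃* FreeGroup α) (g h : FreeGroup α) :
    wordDist (Set.range fun a => ψ (of a)) g h = norm ((ψ.symm g)⁻¹ * ψ.symm h) := by
  rw [wordDist, wordLength_range_basis, _root_.map_mul, _root_.map_inv]

theorem gromov_wordDist_range_basis (ψ : FreeGroup α ≃* FreeGroup α) (g h : FreeGroup α) :
    gromov (wordDist (Set.range fun a => ψ (of a))) 1 g h =
      prefixProduct (ψ.symm g) (ψ.symm h) := by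
  have h1 := norm_inv_mul_add_prefixProduct (ψ.symm g) (ψ.symm h)
  simp only [gromov, wordDist_range_basis, _root_.map_one, inv_one, one_mul]
  rify at h1
  linarith

theorem inVisual_visualRhoOf (ψ : FreeGroup α ≃* FreeGroup α) :
    InVisual (Set.range fun a => ψ (of a)) 1 1 1
      (visualRhoOf (wordDist (Set.range fun a => ψ (of a))) 1 1) := by
  refine ⟨⟨fun x => by simp [visualRhoOf], fun x y h => ?_, fun x y => ?_, fun x y z => ?_⟩,
    fun g h _ => by simp⟩
  · by_contra hne
    rw [visualRhoOf, if_neg hne] at h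
    exact (Real.exp_pos _).ne' h
  · simp only [visualRhoOf, gromov_wordDist_range_basis, eq_comm (a := x), prefixProduct_comm]
  · simp only [visualRhoOf, gromov_wordDist_range_basis]
    have h := min_prefixProduct_le (ψ.symm x) (ψ.symm y) (ψ.symm z)
    split_ifs with h1 h2 h3 h3 h2 h3 h3
    all_goals try subst h1
    all_goals try subst h2
    all_goals try subst h3
    all_goals first | positivity | simp at *
    rcases h with h | h
    · refine le_add_of_le_of_nonneg (Real.exp_le_exp.2 ?_) (Real.exp_pos _).le
      simpa using h
    · refine le_add_of_nonneg_of_le (Real.exp_pos _).le (Real.exp_le_exp.2 ?_)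
      simpa using h

theorem exists_norm_le_of_lipschitzCond [Nonempty α] (ψ : FreeGroup α ≃* FreeGroup α)
    (φ : MulAut (FreeGroup α))
    (h : LipschitzCond (visualRhoOf (wordDist (Set.range fun a => ψ (of a))) 1 1)
      (visualRhoOf (wordDist (Set.range fun a => ψ (of a))) 1 1) φ) :
    ∃ C : ℕ, ∀ g, norm (ψ.symm g) ≤ norm (ψ.symm (φ g)) + C := by
  obtain ⟨K, hK, h⟩ := h
  obtain ⟨a⟩ := ‹Nonempty α›
  refine ⟨⌈Real.log K⌉₊ + 1, fun g => ?_⟩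
  have hne : g ≠ g * ψ (of a) := by
    intro h1
    simp at h1
  have h1 := h g (g * ψ (of a))
  rw [visualRhoOf, visualRhoOf, if_neg hne, if_neg (φ.injective.ne hne),
    gromov_wordDist_range_basis, gromov_wordDist_range_basis, ← Real.exp_log hK, ← Real.exp_add,
    Real.exp_le_exp] at h1
  have h2 := norm_inv_mul_add_prefixProduct (ψ.symm g) (ψ.symm (g * ψ (of a)))
  have h3 := norm_inv_mul_add_prefixProduct (ψ.symm (φ g)) (ψ.symm (φ (g * ψ (of a))))
  have h5 := norm_mul_le (ψ.symm g * of a) (of a)⁻¹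
  have h6 := norm_mul_le (ψ.symm (φ g)) ((ψ.symm (φ g))⁻¹ * ψ.symm (φ (g * ψ (of a))))
  rw [mul_inv_cancel_left] at h6
  rw [mul_inv_cancel_right, norm_inv_eq, norm_of] at h5
  rw [_root_.map_mul ψ.symm g, MulEquiv.symm_apply_apply, inv_mul_cancel_left, norm_of] at h2
  rw [_root_.map_mul ψ.symm g, MulEquiv.symm_apply_apply] at h1
  have h7 := Nat.le_ceil (Real.log K)
  have h8 : (prefixProduct (ψ.symm g) (ψ.symm g * of a) : ℝ) ≤
      prefixProduct (ψ.symm (φ g)) (ψ.symm (φ (g * ψ (of a)))) + (⌈Real.log K⌉₊ : ℕ) := by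
    linarith
  norm_cast at h8
  omega

end WordMetric

theorem _root_.lipschitzCond_of_almost_isometry {X : Type*} {dA d : X → X → ℝ} {p : X} {γ T : ℝ}
    (hγ : 0 < γ) (hT : 1 ≤ T) (htri : ∀ x y z, dA x z ≤ dA x y + dA y z)
    (hd : InVisualOf dA p γ T d) {φ : X → X} {C : ℝ}
    (hφ : ∀ x y, |dA (φ x) (φ y) - dA x y| ≤ C) : LipschitzCond d d φ := by
  obtain ⟨hm, hd⟩ := hd
  refine ⟨T * T * Real.exp (γ * (3 * C / 2 + dA (φ p) p)), by positivity, fun g h => ?_⟩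
  by_cases hgh : g = h
  · subst hgh
    simp [hm.refl]
  have hlow := (hd g h hgh).1
  rw [visualRhoOf, if_neg hgh, div_le_iff₀ (by linarith)] at hlow
  by_cases hφgh : φ g = φ h
  · rw [hφgh, hm.refl]
    have : 0 ≤ d g h := by
      by_contra! hneg
      have := Real.exp_pos (-γ * gromov dA p g h)
      nlinarith
    positivity
  have hup := (hd _ _ hφgh).2
  rw [visualRhoOf, if_neg hφgh] at hup
  have h1 := abs_le.1 (hφ p g)
  have h2 := abs_le.1 (hφ p h)
  have h3 := abs_le.1 (hφ g h)
  have h4 := htri (φ p) p (φ g)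
  have h5 := htri (φ p) p (φ h)
  have h6 : gromov dA p g h - (3 * C / 2 + dA (φ p) p) ≤ gromov dA p (φ g) (φ h) := by
    simp only [gromov]
    linarith
  have h7 : Real.exp (-γ * gromov dA p (φ g) (φ h)) ≤
      Real.exp (γ * (3 * C / 2 + dA (φ p) p)) * Real.exp (-γ * gromov dA p g h) := by
    rw [← Real.exp_add, Real.exp_le_exp]
    nlinarith
  calc d (φ g) (φ h) ≤ T * Real.exp (-γ * gromov dA p (φ g) (φ h)) := hup
    _ ≤ T * (Real.exp (γ * (3 * C / 2 + dA (φ p) p)) * (d g h * T)) := by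
      gcongr
      exact h7.trans (by gcongr)
    _ = _ := by ring

theorem mk_mul_mk_comm {α : Type*} (i : α) (b b' : Bool) :
    (mk [(i, b)] : FreeGroup α) * mk [(i, b')] = mk [(i, b')] * mk [(i, b)] := by
  have h : (mk [(i, false)] : FreeGroup α) = (mk [(i, true)])⁻¹ := by simp [inv_mk, invRev]
  cases b <;> cases b' <;> simp only [h, inv_mul_cancel, mul_inv_cancel]

theorem exists_mk_eq_zpow {α : Type*} (i : α) (b : Bool) : ∃ m : ℤ, (mk [(i, b)] : FreeGroup α) = of i ^ m := by
  cases b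
  · exact ⟨-1, by simp [of, inv_mk, invRev]⟩
  · exact ⟨1, by simp [of]⟩

section CyclicNorm

variable {α : Type*} [DecidableEq α]

theorem cyclicNorm_mk_of_isCyclicallyReduced {L : List (α × Bool)} (h : IsCyclicallyReduced L) :
    cyclicNorm (mk L) = L.length := by
  have h1 := norm_pow_succ (mk L) 0
  have h2 := norm_pow_succ (mk L) 1
  rw [pow_mk, norm_mk_of_isReduced (h.flatten_replicate _).isReduced] at h1 h2
  simp at h1 h2
  omega

theorem cyclicNorm_conj_le (c x : FreeGroup α) : cyclicNorm (c * x * c⁻¹) ≤ cyclicNorm x := by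
  refine cyclicNorm_le_of_norm_pow_le
    (C := 2 * norm c + 2 * (reduceCyclically.conjugator x.toWord).length) fun n => ?_
  rw [conj_pow]
  have h1 := norm_mul_le (c * x ^ n) c⁻¹
  have h2 := norm_mul_le c (x ^ n)
  rw [norm_inv_eq] at h1
  cases n with
  | zero =>
    simp
  | succ n =>
    have h3 := norm_pow_succ x n
    rw [mul_comm (n + 1)] at h3
    omega

/-- If `x * (w * y * w⁻¹)` is conjugate to a word of length at most two, where `x` and `y` are
powers of distinct letters, then `w` cancels against the centralizers of `x` and `y`. -/
theorem exists_eq_zpow_mul_zpow {i j : α} (hij : i ≠ j) (b b' : Bool) (n : ℕ) (w : FreeGroup α)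
    (hn : norm w ≤ n) (hw : cyclicNorm (mk [(i, b)] * (w * mk [(j, b')] * w⁻¹)) ≤ 2) :
    ∃ k l : ℤ, w = of i ^ k * of j ^ l := by
  induction n generalizing w with
  | zero =>
    refine ⟨0, 0, ?_⟩
    simpa using norm_eq_zero.1 (Nat.le_zero.1 hn)
  | succ n ih =>
    by_cases h1 : ∃ p ∈ w.toWord.head?, p.1 = i
    · obtain ⟨⟨p, s⟩, hp, rfl⟩ := h1
      obtain ⟨L, hL⟩ := List.head?_eq_some_iff.1 hp
      have hwL : w = mk [(p, s)] * mk L := by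
        rw [mul_mk, ← mk_toWord (x := w), hL]; rfl
      have hLn : norm (mk L) ≤ n := by
        refine norm_mk_le.trans ?_
        have : norm w = L.length + 1 := by rw [norm, hL]; rfl
        omega
      obtain ⟨k, l, hkl⟩ := ih (mk L) hLn <| by
        refine le_trans (le_of_eq ?_) ((cyclicNorm_conj_le (mk [(p, s)])⁻¹ _).trans hw)
        congr 1
        rw [hwL]
        generalize mk L = v
        have := mk_mul_mk_comm p b s
        generalize mk [(p, b)] = x at *
        generalize mk [(p, s)] = t at *
        simp only [mul_assoc, inv_inv, mul_inv_rev, inv_mul_cancel, mul_one]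
        rw [← mul_assoc x t, this]
        simp only [mul_assoc, inv_mul_cancel_left]
      obtain ⟨m, hm⟩ := exists_mk_eq_zpow p s
      exact ⟨m + k, l, by rw [hwL, hkl, hm, zpow_add, mul_assoc]⟩
    by_cases h2 : ∃ p ∈ w.toWord.getLast?, p.1 = j
    · obtain ⟨⟨p, s⟩, hp, rfl⟩ := h2
      obtain ⟨L, hL⟩ := List.getLast?_eq_some_iff.1 hp
      have hwL : w = mk L * mk [(p, s)] := by
        rw [mul_mk, ← mk_toWord (x := w), hL]
      have hLn : norm (mk L) ≤ n := by
        refine norm_mk_le.trans ?_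
        have : norm w = L.length + 1 := by rw [norm, hL]; simp
        omega
      obtain ⟨k, l, hkl⟩ := ih (mk L) hLn <| by
        refine le_trans (le_of_eq ?_) hw
        congr 2
        rw [hwL]
        generalize mk L = v
        have := mk_mul_mk_comm p b' s
        generalize mk [(p, b')] = x at *
        generalize mk [(p, s)] = t at *
        rw [mul_inv_rev, mul_assoc v t x, ← this]
        group
      obtain ⟨m, hm⟩ := exists_mk_eq_zpow p s
      exact ⟨k, l + m, by rw [hwL, hkl, hm, zpow_add, mul_assoc]⟩
    by_cases hw1 : w.toWord = []
    · exact ⟨0, 0, by simpa using hw1⟩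
    exfalso
    have hred := isReduced_toWord (x := w)
    rw [← mk_toWord (x := w)] at hw
    generalize w.toWord = W at *
    push Not at h1 h2
    have hinvhead : (invRev W).head? = W.getLast?.map fun g => (g.1, !g.2) := by
      simp [invRev]
    have hinvlast : (invRev W).getLast? = W.head?.map fun g => (g.1, !g.2) := by
      simp [invRev]
    have hcyc : IsCyclicallyReduced ([(i, b)] ++ (W ++ [(j, b')] ++ invRev W)) := by
      obtain ⟨f, hf⟩ : ∃ f, W.head? = some f := Option.ne_none_iff_exists'.1 (by simpa using hw1)
      obtain ⟨l, hl⟩ : ∃ l, W.getLast? = some l :=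
        Option.ne_none_iff_exists'.1 (by simpa using hw1)
      have hfi := h1 f hf
      have hlj := h2 l hl
      rw [isCyclicallyReduced_iff, isReduced_append_iff, isReduced_append_iff,
        isReduced_append_iff]
      simp only [List.getLast?_append, List.head?_append, hinvhead, hinvlast, hf, hl,
        hred, hred.invRev_isReduced]
      simp
      grind
    rw [inv_mk, mul_mk, mul_mk, mul_mk, cyclicNorm_mk_of_isCyclicallyReduced hcyc] at hw
    have := List.length_pos_iff.2 hw1
    simp at hw
    omega

end CyclicNorm

section RankTwo

variable {ε : MulAut (FreeGroup (Fin 2))}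

theorem inversion_mk (hε : ∀ i, ε (of i) = (of i)⁻¹) (i : Fin 2) (b : Bool) :
    ε (mk [(i, b)]) = (mk [(i, b)])⁻¹ := by
  obtain ⟨m, hm⟩ := exists_mk_eq_zpow i b
  rw [hm, _root_.map_zpow, hε, inv_zpow]

theorem inversion_inversion (hε : ∀ i, ε (of i) = (of i)⁻¹) (g : FreeGroup (Fin 2)) :
    ε (ε g) = g := by
  have : (ε.toMonoidHom.comp ε.toMonoidHom) = MonoidHom.id _ := ext_hom _ _ fun i => by simp [hε]
  exact DFunLike.congr_fun this g

theorem norm_inversion (hε : ∀ i, ε (of i) = (of i)⁻¹) (g : FreeGroup (Fin 2)) :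
    norm (ε g) = norm g := by
  have key : ∀ g, norm (ε g) ≤ norm g := by
    intro g
    have h : ε g = (g.toWord.map fun p => ε (mk [p])).prod := by
      conv_lhs => rw [← mk_toWord (x := g)]
      generalize g.toWord = L
      induction L with
      | nil => simp [← one_eq_mk]
      | cons p L ih => rw [List.map_cons, List.prod_cons, ← ih, ← _root_.map_mul, mul_mk]; rfl
    rw [h]
    refine (norm_list_prod_le ?_).trans (by rw [List.length_map]; rfl)
    simp only [List.mem_map]
    rintro x ⟨p, -, rfl⟩
    rw [inversion_mk hε p.1 p.2, norm_inv_eq]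
    exact norm_mk_le
  refine (key g).antisymm ?_
  conv_lhs => rw [← inversion_inversion hε g]
  exact key _

/-- The inversion `ε` acts on every generating pair as inversion, up to conjugation. -/
theorem exists_inversion_eq_conj (hε : ∀ i, ε (of i) = (of i)⁻¹) {u v : FreeGroup (Fin 2)}
    (h : Subgroup.closure {u, v} = ⊤) : ∃ y, ε u = y⁻¹ * u⁻¹ * y ∧ ε v = y⁻¹ * v⁻¹ * y := by
  have hP : IsNielsenInvariant fun u v : FreeGroup (Fin 2) =>
      ∃ y, ε u = y⁻¹ * u⁻¹ * y ∧ ε v = y⁻¹ * v⁻¹ * y := by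
    refine ⟨?_, ?_, ?_, ?_⟩
    · rintro u v ⟨y, h1, h2⟩
      exact ⟨y, h2, h1⟩
    · rintro u v ⟨y, h1, h2⟩
      refine ⟨y, ?_, h2⟩
      rw [_root_.map_inv, inv_eq_iff_eq_inv] at h1
      rw [h1]
      group
    · rintro u v ⟨y, h1, h2⟩
      refine ⟨v * y, ?_, by rw [h2]; group⟩
      rw [_root_.map_mul, ← eq_mul_inv_iff_mul_eq] at h1
      rw [h1, h2]
      group
    · rintro r u v ⟨y, h1, h2⟩
      refine ⟨r * y * (ε r)⁻¹, ?_, ?_⟩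
      · rw [_root_.map_mul, _root_.map_mul, _root_.map_inv, ← eq_mul_inv_iff_mul_eq,
          inv_mul_eq_iff_eq_mul] at h1
        rw [h1]
        group
      · rw [_root_.map_mul, _root_.map_mul, _root_.map_inv, ← eq_mul_inv_iff_mul_eq,
          inv_mul_eq_iff_eq_mul] at h2
        rw [h2]
        group
  refine hP.holds_of_closure_eq_top (fun u v huv => ?_) h
  have h01 : (of 0 : FreeGroup (Fin 2)) ≠ of 1 := fun h => by simpa using of_injective h
  have h01' : (of 0 : FreeGroup (Fin 2)) ≠ (of 1)⁻¹ := fun h => by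
    simpa [toWord_inv, invRev] using congrArg toWord h
  have h0 := hε 0
  have h1 := hε 1
  refine ⟨1, ?_⟩
  rcases huv (of 0) (norm_of 0) with h | h | h | h <;>
    rcases huv (of 1) (norm_of 1) with h' | h' | h' | h' <;>
    simp_all [inv_eq_iff_eq_inv]

theorem closure_range_basis_eq_top (ψ : FreeGroup (Fin 2) ≃* FreeGroup (Fin 2)) :
    Subgroup.closure {ψ (of 0), ψ (of 1)} = ⊤ := by
  have h := congrArg (Subgroup.map ψ.toMonoidHom) (closure_range_of (Fin 2))
  rw [MonoidHom.map_closure, Subgroup.map_top_of_surjective _ ψ.surjective] at h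
  rw [← h]
  congr 1
  ext x
  simp [Fin.exists_fin_two, eq_comm]

theorem exists_inversion_apply_eq (hε : ∀ i, ε (of i) = (of i)⁻¹)
    (ψ : FreeGroup (Fin 2) ≃* FreeGroup (Fin 2)) : ∃ y, ∀ g, ε (ψ g) = y⁻¹ * ψ (ε g) * y := by
  obtain ⟨y, h0, h1⟩ := exists_inversion_eq_conj hε (closure_range_basis_eq_top ψ)
  refine ⟨y, fun g => ?_⟩
  have : ε.toMonoidHom.comp ψ.toMonoidHom =
      (MulAut.conj y⁻¹).toMonoidHom.comp (ψ.toMonoidHom.comp ε.toMonoidHom) := by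
    refine ext_hom _ _ fun i => ?_
    fin_cases i <;> simp [h0, h1, hε]
  simpa using DFunLike.congr_fun this g

theorem abs_wordDist_sub_le (hε : ∀ i, ε (of i) = (of i)⁻¹)
    (ψ : FreeGroup (Fin 2) ≃* FreeGroup (Fin 2)) {φ : MulAut (FreeGroup (Fin 2))} {k : ℕ}
    (hk : k ≤ 1) {x : FreeGroup (Fin 2)} (hφ : ∀ g, φ g = x⁻¹ * (ε ^ k) g * x) :
    ∃ C : ℝ, ∀ g h, |wordDist (Set.range fun a => ψ (of a)) (φ g) (φ h) -
      wordDist (Set.range fun a => ψ (of a)) g h| ≤ C := by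
  obtain ⟨z, hz⟩ : ∃ z, ∀ g, ψ.symm (φ g) = z⁻¹ * (ε ^ k) (ψ.symm g) * z := by
    obtain rfl | rfl : k = 0 ∨ k = 1 := by omega
    · exact ⟨ψ.symm x, fun g => by simp [hφ]⟩
    · obtain ⟨y, hy⟩ := exists_inversion_apply_eq hε ψ
      refine ⟨ψ.symm (y * x), fun g => ?_⟩
      have := hy (ψ.symm g)
      rw [MulEquiv.apply_symm_apply] at this
      rw [hφ, pow_one, this]
      simp [mul_assoc]
  refine ⟨(2 * norm z : ℕ), fun g h => ?_⟩
  have hnorm : ∀ g, norm ((ε ^ k) g) = norm g := by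
    obtain rfl | rfl : k = 0 ∨ k = 1 := by omega
    · simp
    · simpa using norm_inversion hε
  rw [wordDist_range_basis, wordDist_range_basis, ← _root_.map_inv, ← _root_.map_mul,
    ← _root_.map_inv, ← _root_.map_mul, ← _root_.map_inv, ← _root_.map_mul, hz,
    ← hnorm (ψ.symm (g⁻¹ * h))]
  generalize (ε ^ k) (ψ.symm (g⁻¹ * h)) = t
  have h1 := norm_mul_le (z⁻¹ * t) z
  have h2 := norm_mul_le z⁻¹ t
  have h3 := norm_mul_le (z * (z⁻¹ * t * z)) z⁻¹
  have h4 := norm_mul_le z (z⁻¹ * t * z)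
  have h5 : z * (z⁻¹ * t * z) * z⁻¹ = t := by group
  rw [norm_inv_eq] at h2 h3
  rw [h5] at h3
  rw [abs_le]
  rify at *
  constructor <;> linarith

theorem lipschitzCond_of_eq_conj (hε : ∀ i, ε (of i) = (of i)⁻¹)
    (ψ : FreeGroup (Fin 2) ≃* FreeGroup (Fin 2)) {φ : MulAut (FreeGroup (Fin 2))} {k : ℕ}
    (hk : k ≤ 1) {x : FreeGroup (Fin 2)} (hφ : ∀ g, φ g = x⁻¹ * (ε ^ k) g * x)
    {p : FreeGroup (Fin 2)} {γ T : ℝ} (hγ : 0 < γ) (hT : 1 ≤ T)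
    {d : FreeGroup (Fin 2) → FreeGroup (Fin 2) → ℝ}
    (hd : InVisual (Set.range fun a => ψ (of a)) p γ T d) : LipschitzCond d d φ := by
  obtain ⟨C, hC⟩ := abs_wordDist_sub_le hε ψ hk hφ
  refine lipschitzCond_of_almost_isometry hγ hT (fun x y z => ?_) hd hC
  simp only [wordDist_range_basis]
  have := norm_mul_le ((ψ.symm x)⁻¹ * ψ.symm y) ((ψ.symm y)⁻¹ * ψ.symm z)
  rw [mul_assoc, mul_inv_cancel_left] at this
  exact_mod_cast this

/-- The sum of the exponents of the letter `i` in a word. -/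
def exponentSum (i : Fin 2) (g : FreeGroup (Fin 2)) : ℤ :=
  Multiplicative.toAdd (lift (fun j => Multiplicative.ofAdd (if j = i then (1 : ℤ) else 0)) g)

theorem exponentSum_mul (i : Fin 2) (g h : FreeGroup (Fin 2)) :
    exponentSum i (g * h) = exponentSum i g + exponentSum i h := by
  simp [exponentSum]

theorem exponentSum_inv (i : Fin 2) (g : FreeGroup (Fin 2)) :
    exponentSum i g⁻¹ = -exponentSum i g := by
  simp [exponentSum]

theorem exponentSum_of (i j : Fin 2) : exponentSum i (of j) = if j = i then 1 else 0 := by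
  simp [exponentSum]

theorem exponentSum_mk (i j : Fin 2) (b : Bool) :
    exponentSum i (mk [(j, b)]) = if j = i then (if b then 1 else -1) else 0 := by
  cases b
  · have : (mk [(j, false)] : FreeGroup (Fin 2)) = (of j)⁻¹ := by simp [of, inv_mk, invRev]
    rw [this, exponentSum_inv, exponentSum_of]
    by_cases hj : j = i <;> simp [hj]
  · exact (exponentSum_of i j).trans (by simp)

theorem exponentSum_conj (i : Fin 2) (c g : FreeGroup (Fin 2)) :
    exponentSum i (c * g * c⁻¹) = exponentSum i g := by
  simp only [exponentSum_mul, exponentSum_inv]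
  ring

/-- The automorphism `a ↦ a`, `b ↦ a * b`. -/
def leftTransvection : FreeGroup (Fin 2) ≃* FreeGroup (Fin 2) :=
  MonoidHom.toMulEquiv (lift ![of 0, of 0 * of 1]) (lift ![of 0, (of 0)⁻¹ * of 1])
    (ext_hom _ _ fun i => by fin_cases i <;> simp) (ext_hom _ _ fun i => by fin_cases i <;> simp)

/-- The automorphism `a ↦ a * b`, `b ↦ b`. -/
def rightTransvection : FreeGroup (Fin 2) ≃* FreeGroup (Fin 2) :=
  MonoidHom.toMulEquiv (lift ![of 0 * of 1, of 1]) (lift ![of 0 * (of 1)⁻¹, of 1])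
    (ext_hom _ _ fun i => by fin_cases i <;> simp) (ext_hom _ _ fun i => by fin_cases i <;> simp)

theorem leftTransvection_of_zero : leftTransvection (of 0) = of 0 := by
  simp [leftTransvection]

theorem leftTransvection_of_one : leftTransvection (of 1) = of 0 * of 1 := by
  simp [leftTransvection]

theorem rightTransvection_of_zero : rightTransvection (of 0) = of 0 * of 1 := by
  simp [rightTransvection]

theorem rightTransvection_of_one : rightTransvection (of 1) = of 1 := by
  simp [rightTransvection]

theorem exists_symm_eq_conj {φ : MulAut (FreeGroup (Fin 2))}
    (h : ∀ ψ : FreeGroup (Fin 2) ≃* FreeGroup (Fin 2), ∀ g,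
      cyclicNorm (ψ.symm (φ.symm g)) ≤ norm (ψ.symm g))
    (ψ : FreeGroup (Fin 2) ≃* FreeGroup (Fin 2)) (i : Fin 2) :
    ∃ c j b, φ.symm (ψ (of i)) = c * ψ (mk [(j, b)]) * c⁻¹ := by
  have h1 := h ψ (ψ (of i))
  obtain ⟨c, y, hc, hy⟩ := exists_eq_conj_norm_eq_cyclicNorm (ψ.symm (φ.symm (ψ (of i))))
  rw [MulEquiv.symm_apply_apply, norm_of, ← hy] at h1
  rcases Nat.le_one_iff_eq_zero_or_eq_one.1 h1 with h0 | h0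
  · rw [norm_eq_zero.1 h0] at hc
    simp at hc
  · obtain ⟨⟨j, b⟩, rfl⟩ := norm_eq_one_iff.1 h0
    refine ⟨ψ c, j, b, ?_⟩
    rw [MulEquiv.symm_apply_eq] at hc
    simpa using hc

theorem exists_symm_of_eq_conj {φ : MulAut (FreeGroup (Fin 2))}
    (h : ∀ ψ : FreeGroup (Fin 2) ≃* FreeGroup (Fin 2), ∀ g,
      cyclicNorm (ψ.symm (φ.symm g)) ≤ norm (ψ.symm g)) :
    ∃ b c e, φ.symm (of 0) = c * mk [(0, b)] * c⁻¹ ∧ φ.symm (of 1) = e * mk [(1, b)] * e⁻¹ := by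
  obtain ⟨c, j, b, h1⟩ := exists_symm_eq_conj h (MulEquiv.refl _) 0
  obtain ⟨e, j', b', h2⟩ := exists_symm_eq_conj h (MulEquiv.refl _) 1
  obtain ⟨c₃, j₃, b₃, h3⟩ := exists_symm_eq_conj h leftTransvection 0
  obtain ⟨c₄, j₄, b₄, h4⟩ := exists_symm_eq_conj h leftTransvection 1
  obtain ⟨c₅, j₅, b₅, h5⟩ := exists_symm_eq_conj h rightTransvection 1
  have hl : ∀ i (j : Fin 2) b, exponentSum i (leftTransvection (mk [(j, b)])) =
      exponentSum i (leftTransvection (of j)) * (if b then 1 else -1) := by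
    intro i j b
    cases b
    · have : (mk [(j, false)] : FreeGroup (Fin 2)) = (of j)⁻¹ := by simp [of, inv_mk, invRev]
      simp [this, exponentSum_inv]
    · simp [of]
  have hr : ∀ i (j : Fin 2) b, exponentSum i (rightTransvection (mk [(j, b)])) =
      exponentSum i (rightTransvection (of j)) * (if b then 1 else -1) := by
    intro i j b
    cases b
    · have : (mk [(j, false)] : FreeGroup (Fin 2)) = (of j)⁻¹ := by simp [of, inv_mk, invRev]
      simp [this, exponentSum_inv]
    · simp [of]
  rw [leftTransvection_of_zero] at h3
  rw [leftTransvection_of_one, _root_.map_mul] at h4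
  rw [rightTransvection_of_one] at h5
  simp only [MulEquiv.refl_apply] at h1 h2
  have e3 : ∀ i, _ := fun i => congrArg (exponentSum i) h3
  have e4 : ∀ i, _ := fun i => congrArg (exponentSum i) h4
  have e5 : ∀ i, _ := fun i => congrArg (exponentSum i) h5
  simp only [h1, h2, exponentSum_mul _ (_ * _ * _) (_ * _ * _), exponentSum_conj, hl, hr,
    exponentSum_mk] at e3 e4 e5
  have hj : j = 0 := by
    have a0 := e3 0
    have a1 := e3 1
    clear h1 h2 h3 h4 h5 e3 e4 e5
    fin_cases j <;> fin_cases j₃ <;> cases b <;> cases b₃ <;>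
      simp_all [leftTransvection_of_zero, leftTransvection_of_one, exponentSum_mul,
        exponentSum_of]
  have hj' : j' = 1 := by
    have a0 := e5 0
    have a1 := e5 1
    clear h1 h2 h3 h4 h5 e3 e4 e5
    fin_cases j' <;> fin_cases j₅ <;> cases b' <;> cases b₅ <;>
      simp_all [rightTransvection_of_zero, rightTransvection_of_one, exponentSum_mul,
        exponentSum_of]
  subst hj hj'
  have hb : b' = b := by
    have a0 := e4 0
    have a1 := e4 1
    clear h1 h2 h3 h4 h5 e3 e4 e5
    fin_cases j₄ <;> cases b <;> cases b' <;> cases b₄ <;>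
      simp_all [leftTransvection_of_zero, leftTransvection_of_one, exponentSum_mul,
        exponentSum_of]
  subst hb
  exact ⟨_, c, e, h1, h2⟩

theorem exists_eq_conj_of_cyclicNorm_le (hε : ∀ i, ε (of i) = (of i)⁻¹)
    {φ : MulAut (FreeGroup (Fin 2))}
    (h : ∀ ψ : FreeGroup (Fin 2) ≃* FreeGroup (Fin 2), ∀ g,
      cyclicNorm (ψ.symm (φ.symm g)) ≤ norm (ψ.symm g)) :
    ∃ k : ℕ, k ≤ 1 ∧ ∃ x, ∀ g, φ g = x⁻¹ * (ε ^ k) g * x := by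
  obtain ⟨b, c, e, h0, h1⟩ := exists_symm_of_eq_conj h
  have hab : cyclicNorm (φ.symm (of 0 * of 1)) ≤ 2 := by
    have h2 := norm_mul_le (of (0 : Fin 2)) (of 1)
    rw [norm_of, norm_of] at h2
    exact (h (MulEquiv.refl _) (of 0 * of 1)).trans h2
  obtain ⟨k, l, hkl⟩ := exists_eq_zpow_mul_zpow (i := (0 : Fin 2)) (j := 1) (by decide) b b _
    (c⁻¹ * e) le_rfl <| by
      refine le_trans (le_of_eq ?_) ((cyclicNorm_conj_le c⁻¹ _).trans hab)
      rw [_root_.map_mul, h0, h1]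
      congr 1
      group
  rw [inv_mul_eq_iff_eq_mul] at hkl
  obtain ⟨n, hn, hεn⟩ : ∃ n : ℕ, n ≤ 1 ∧ ∀ i : Fin 2, mk [(i, b)] = (ε ^ n) (of i) := by
    cases b
    · exact ⟨1, le_rfl, fun i => by rw [pow_one, hε]; simp [of, inv_mk, invRev]⟩
    · exact ⟨0, zero_le_one, fun i => by simp [of]⟩
  have hcomm : ∀ (i : Fin 2) (m : ℤ), of i ^ m * mk [(i, b)] * (of i ^ m)⁻¹ = mk [(i, b)] := by
    intro i m
    obtain ⟨t, ht⟩ := exists_mk_eq_zpow i b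
    rw [ht]
    group
  have hinv : ∀ g, (ε ^ n) ((ε ^ n) g) = g := by
    obtain rfl | rfl : n = 0 ∨ n = 1 := by omega
    · simp
    · simpa using inversion_inversion hε
  have key : φ.symm.toMonoidHom =
      (MulAut.conj (c * of 0 ^ k)).toMonoidHom.comp (ε ^ n).toMonoidHom := by
    refine ext_hom _ _ fun i => ?_
    fin_cases i
    · have := hcomm 0 k
      simp only [Fin.zero_eta, MulEquiv.toMonoidHom_eq_coe, MonoidHom.coe_coe, MonoidHom.comp_apply,
        MulAut.conj_apply, h0, ← hεn]
      nth_rw 1 [← this]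
      group
    · have := hcomm 1 l
      simp only [Fin.mk_one, MulEquiv.toMonoidHom_eq_coe, MonoidHom.coe_coe, MonoidHom.comp_apply,
        MulAut.conj_apply, h1, ← hεn]
      nth_rw 2 [← this]
      rw [hkl]
      group
  refine ⟨n, hn, φ (c * of 0 ^ k), fun g => ?_⟩
  have h2 := DFunLike.congr_fun key ((ε ^ n) g)
  simp only [MulEquiv.toMonoidHom_eq_coe, MonoidHom.coe_coe, MonoidHom.comp_apply,
    MulAut.conj_apply, hinv] at h2
  rw [MulEquiv.symm_apply_eq, _root_.map_mul, _root_.map_mul, _root_.map_inv] at h2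
  rw [h2]
  group

theorem cyclicNorm_symm_le {φ : MulAut (FreeGroup (Fin 2))}
    {ψ : FreeGroup (Fin 2) ≃* FreeGroup (Fin 2)}
    (h : LipschitzCond (visualRhoOf (wordDist (Set.range fun a => ψ (of a))) 1 1)
      (visualRhoOf (wordDist (Set.range fun a => ψ (of a))) 1 1) φ) (g : FreeGroup (Fin 2)) :
    cyclicNorm (ψ.symm (φ.symm g)) ≤ norm (ψ.symm g) := by
  obtain ⟨C, hC⟩ := exists_norm_le_of_lipschitzCond ψ φ h
  refine cyclicNorm_le_of_norm_pow_le (C := C) fun n => ?_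
  have h1 := hC (φ.symm (g ^ n))
  rw [MulEquiv.apply_symm_apply, _root_.map_pow, _root_.map_pow] at h1
  refine h1.trans (Nat.add_le_add_right ?_ C)
  clear h1
  rw [_root_.map_pow]
  induction n with
  | zero => simp
  | succ n ih =>
    have h2 := norm_mul_le (ψ.symm g ^ n) (ψ.symm g)
    rw [← pow_succ] at h2
    rw [mul_add]
    omega

end RankTwo

end FreeGroup

/-- Let `ε` be the automorphism of `F₂` inverting both generators. An
automorphism `φ` of `F₂` satisfies a Lipschitz condition with respect to every visual
metric taken over a *basis* of `F₂` iff `φ ∈ ⟨Inn(F₂) ∪ {ε}⟩`, i.e. `φ` is the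
composition of `ε^k` (`k ∈ {0,1}`) with an inner automorphism. -/
theorem stmt_18 (ε φ : MulAut (FreeGroup (Fin 2)))
    (hε : ∀ i : Fin 2, ε (FreeGroup.of i) = (FreeGroup.of i)⁻¹) :
    (∀ A' : Set (FreeGroup (Fin 2)),
      (∃ ψ : FreeGroup (Fin 2) ≃* FreeGroup (Fin 2),
        A' = Set.range fun a : Fin 2 => ψ (FreeGroup.of a)) →
      ∀ (p' : FreeGroup (Fin 2)) (γ' T : ℝ), 0 < γ' → 1 ≤ T →
        ∀ d : FreeGroup (Fin 2) → FreeGroup (Fin 2) → ℝ, InVisual A' p' γ' T d →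
          LipschitzCond d d ⇑φ) ↔
      ∃ k : ℕ, k ≤ 1 ∧ ∃ x : FreeGroup (Fin 2),
        ∀ g : FreeGroup (Fin 2), φ g = x⁻¹ * (ε ^ k) g * x := by
  constructor
  · intro h
    refine FreeGroup.exists_eq_conj_of_cyclicNorm_le hε fun ψ g => ?_
    exact FreeGroup.cyclicNorm_symm_le
      (h _ ⟨ψ, rfl⟩ 1 1 1 one_pos le_rfl _ (FreeGroup.inVisual_visualRhoOf ψ)) g
  · rintro ⟨k, hk, x, hφ⟩ A' ⟨ψ, rfl⟩ p γ T hγ hT d hd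
    exact FreeGroup.lipschitzCond_of_eq_conj hε ψ hk hφ hγ hT hd
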